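/- arXiv:1208.1541 — 4 statements merged into one kernel-verified Lean document; each statement's English description precedes it below -/
import Mathlib

section
/- Assume (T1) α|μ| > |1−αδ|, (T2) μ² > 4(1−αδ), (T3) μ > 0, and define the quadratic Q(T) := −α²T² + αμT + α² + αδ − 1. Then Q has exactly one root in the open interval (−1,1), namely T_c = 2B − √(4B²−4A+1); this root is simple; the other root 2B + √(4B²−4A+1) exceeds 1; and Q(T) < 0 for −1 < T < T_c while Q(T) > 0 for T_c < T < 1. Consequently, with ρ₀(x) := sech²x and u₀(x) := δ + μ·tanh(x), the quantity α²ρ₀(x) + αu₀(x) − 1 is negative for x < arctanh(T_c) and positive for x > arctanh(T_c). -/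
open Complex Real Filter Set MeasureTheory ComplexConjugate Topology

noncomputable section

/-- The inverse hyperbolic tangent. -/
def arctanh (x : ℝ) : ℝ := Real.log ((1 + x) / (1 - x)) / 2

/-- The hyperbolic secant. -/
def sech (x : ℝ) : ℝ := 1 / Real.cosh x

/-- The point `z_P = (1-αδ+αμ)/4`. -/
def zP (α δ μ : ℝ) : ℝ := (1 - α*δ + α*μ)/4

/-- The point `z_∞ = (1-αδ-αμ)/4`. -/
def zInf (α δ μ : ℝ) : ℝ := (1 - α*δ - α*μ)/4

/-- The discriminant `α⁴ + α²μ²/4 − α²(1−αδ)`. -/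
def discrm (α δ μ : ℝ) : ℝ := α^4 + α^2*μ^2/4 - α^2*(1 - α*δ)

/-- The point `z⁺`. -/
def zplus (α δ μ : ℝ) : ℝ := (1/2)*((1 - α*δ)/2 - α^2 + Real.sqrt (discrm α δ μ))

/-- The point `z⁻ = z_L`. -/
def zminus (α δ μ : ℝ) : ℝ := (1/2)*((1 - α*δ)/2 - α^2 - Real.sqrt (discrm α δ μ))

/-- `Ω(z) = (2/(iα))(z − (1−αδ)/4)`. -/
def Omg (α δ : ℝ) (z : ℂ) : ℂ := (2 / (Complex.I * α)) * (z - (1 - α * δ) / 4)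

/-- `R(z) = e^{iπ/4}(−i(16z−μ²))^{1/2}` (principal branch). -/
def Rf (μ : ℝ) (z : ℂ) : ℂ :=
  Complex.exp (Complex.I * (π : ℂ) / 4) * (-Complex.I * (16 * z - (μ:ℂ)^2)) ^ ((1:ℂ)/2)

/-- The reflection coefficient `s(z)` (Gamma-function formula). -/
def sRef (α δ μ ε : ℝ) (z : ℂ) : ℂ :=
  -(((2:ℂ) ^ (-(Complex.I * (μ:ℂ)) / (ε:ℂ)) * Complex.I * (ε:ℂ)) /
      (2 * Complex.exp (Complex.I * (π : ℂ) / 4) * (-Complex.I * z) ^ ((1:ℂ)/2))) *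
    (Complex.Gamma (1/2 - Complex.I * (μ:ℂ) / (2*ε) - Omg α δ z / ε) /
      Complex.Gamma (1/2 + Complex.I * (μ:ℂ) / (2*ε) + Omg α δ z / ε)) *
    ((Complex.Gamma (1/2 + Omg α δ z / ε - Rf μ z / (2*ε)) *
      Complex.Gamma (1/2 + Omg α δ z / ε + Rf μ z / (2*ε))) /
      (Complex.Gamma (-(Complex.I * (μ:ℂ)) / (2*ε) - Rf μ z / (2*ε)) *
        Complex.Gamma (-(Complex.I * (μ:ℂ)) / (2*ε) + Rf μ z / (2*ε))))

/-- `A = (1−αδ)/(4α²)`. -/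
def Acoef (α δ : ℝ) : ℝ := (1 - α*δ)/(4*α^2)

/-- `B = μ/(4α)`. -/
def Bcoef (α μ : ℝ) : ℝ := μ/(4*α)

/-- `T_c = 2B − √(4B²−4A+1)`. -/
def Tcrit (α δ μ : ℝ) : ℝ :=
  2*Bcoef α μ - Real.sqrt (4*(Bcoef α μ)^2 - 4*Acoef α δ + 1)

/-- The quadratic `Q(T) = −α²T² + αμT + α² + αδ − 1`. -/
def Qquad (α δ μ : ℝ) (T : ℝ) : ℝ := -α^2*T^2 + α*μ*T + α^2 + α*δ - 1

/-- structure of the roots of `Q` and the sign of the sonic quantity at `t = 0`. -/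
theorem sonic_quadratic_roots (α δ μ : ℝ) (hα : 0 < α)
    (hT1 : α * |μ| > |1 - α*δ|) (hT2 : μ^2 > 4*(1 - α*δ)) (hT3 : 0 < μ) :
    Tcrit α δ μ ∈ Set.Ioo (-1:ℝ) 1 ∧
    Qquad α δ μ (Tcrit α δ μ) = 0 ∧
    (∀ T ∈ Set.Ioo (-1:ℝ) 1, Qquad α δ μ T = 0 → T = Tcrit α δ μ) ∧
    deriv (Qquad α δ μ) (Tcrit α δ μ) ≠ 0 ∧
    Qquad α δ μ (2*Bcoef α μ + Real.sqrt (4*(Bcoef α μ)^2 - 4*Acoef α δ + 1)) = 0 ∧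
    1 < 2*Bcoef α μ + Real.sqrt (4*(Bcoef α μ)^2 - 4*Acoef α δ + 1) ∧
    (∀ T : ℝ, -1 < T → T < Tcrit α δ μ → Qquad α δ μ T < 0) ∧
    (∀ T : ℝ, Tcrit α δ μ < T → T < 1 → Qquad α δ μ T > 0) ∧
    (∀ x : ℝ, x < arctanh (Tcrit α δ μ) →
      α^2*(sech x)^2 + α*(δ + μ*Real.tanh x) - 1 < 0) ∧
    (∀ x : ℝ, arctanh (Tcrit α δ μ) < x →
      α^2*(sech x)^2 + α*(δ + μ*Real.tanh x) - 1 > 0) := by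
  have hA : 1 - α*δ = 4*α^2*Acoef α δ := by unfold Acoef; field_simp
  have hB : μ = 4*α*Bcoef α μ := by unfold Bcoef; field_simp
  have hBpos : 0 < Bcoef α μ := by unfold Bcoef; positivity
  have hα2 : 0 < α^2 := by positivity
  rw [abs_of_pos hT3] at hT1
  obtain ⟨h1, h2⟩ := abs_lt.mp hT1
  unfold Tcrit
  have hQ : ∀ T, Qquad α δ μ T =
      -α^2*(T^2 - 4*Bcoef α μ*T - 1 + 4*Acoef α δ) := by
    intro T
    unfold Qquad
    have : α*μ*T = 4*α^2*Bcoef α μ*T := by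
      calc α*μ*T = α*(4*α*Bcoef α μ)*T := by rw [← hB]
        _ = _ := by ring
    linear_combination this - hA
  have hαμ : α*μ = 4*α^2*Bcoef α μ := by
    calc α*μ = α*(4*α*Bcoef α μ) := by rw [← hB]
      _ = _ := by ring
  have hμ2 : μ^2 = 16*α^2*(Bcoef α μ)^2 := by
    calc μ^2 = (4*α*Bcoef α μ)^2 := by rw [← hB]
      _ = _ := by ring
  rw [hA, hαμ] at h1 h2
  rw [hA, hμ2] at hT2
  generalize Bcoef α μ = B at *
  generalize Acoef α δ = A at *
  have hAB : A < B := by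
    by_contra h; push Not at h; nlinarith
  have hAB' : -B < A := by
    by_contra h; push Not at h; nlinarith
  have hB2 : A < B^2 := by
    by_contra h; push Not at h; nlinarith
  have hs2 : Real.sqrt (4*B^2 - 4*A + 1)^2 = 4*B^2 - 4*A + 1 := Real.sq_sqrt (by linarith)
  have hs0 : 0 < Real.sqrt (4*B^2 - 4*A + 1) := Real.sqrt_pos.mpr (by linarith)
  generalize Real.sqrt (4*B^2 - 4*A + 1) = s at *
  obtain ⟨h3, h4⟩ : -s < 1 - 2*B ∧ 1 - 2*B < s := abs_lt_of_sq_lt_sq' (by nlinarith) hs0.le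
  have h5 : s < 1 + 2*B := lt_of_pow_lt_pow_left₀ 2 (by linarith) (by nlinarith)
  have hF : ∀ T, Qquad α δ μ T = α^2*((T - (2*B - s))*((2*B + s) - T)) := by
    intro T; rw [hQ]; linear_combination (-α^2)*hs2
  have hm : 2*B - s ∈ Set.Ioo (-1:ℝ) 1 := ⟨by linarith, by linarith⟩
  have hneg : ∀ T, T < 2*B - s → Qquad α δ μ T < 0 := by
    intro T hT
    rw [hF]
    exact mul_neg_of_pos_of_neg hα2 (mul_neg_of_neg_of_pos (by linarith) (by linarith))
  have hpos : ∀ T, 2*B - s < T → T < 1 → Qquad α δ μ T > 0 := by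
    intro T hT hT'
    rw [hF]
    exact mul_pos hα2 (mul_pos (by linarith) (by linarith))
  have hat : arctanh (2*B - s) = Real.artanh (2*B - s) := by
    rw [Real.artanh_eq_half_log (Set.Ioo_subset_Icc_self hm)]; unfold arctanh; ring
  have hx : ∀ x : ℝ, α^2*(sech x)^2 + α*(δ + μ*Real.tanh x) - 1 = Qquad α δ μ (Real.tanh x) := by
    intro x
    have hc := Real.cosh_pos x
    have : (sech x)^2 = 1 - (Real.tanh x)^2 := by
      unfold sech
      rw [Real.tanh_eq_sinh_div_cosh]
      field_simp
      linarith [Real.cosh_sq x]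
    rw [this]; unfold Qquad; ring
  have htm : ∀ x : ℝ, Real.tanh x ∈ Set.Ioo (-1:ℝ) 1 := fun x =>
    ⟨Real.neg_one_lt_tanh x, Real.tanh_lt_one x⟩
  refine ⟨hm, ?_, ?_, ?_, ?_, by linarith, fun T _ h => hneg T h, hpos, ?_, ?_⟩
  · rw [hF]; ring
  · intro T hT h0
    rcases lt_trichotomy T (2*B - s) with h | h | h
    · linarith [hneg T h]
    · exact h
    · linarith [hpos T h hT.2]
  · have hd : HasDerivAt (Qquad α δ μ)
        (α^2*(1*((2*B + s) - (2*B - s)) + ((2*B - s) - (2*B - s))*(-1))) (2*B - s) := by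
      rw [funext hF]
      exact ((((hasDerivAt_id' (2*B - s)).sub_const (2*B - s)).mul
        ((hasDerivAt_id' (2*B - s)).const_sub (2*B + s))).const_mul (α^2))
    rw [hd.deriv]
    have : 0 < α^2*(2*s) := by positivity
    intro h
    linarith
  · rw [hF]; ring
  · intro x h
    rw [hat, ← Real.artanh_tanh x, Real.artanh_lt_artanh_iff (htm x) hm] at h
    rw [hx]; exact hneg _ h
  · intro x h
    rw [hat, ← Real.artanh_tanh x, Real.artanh_lt_artanh_iff hm (htm x)] at h
    rw [hx]; exact hpos _ h (htm x).2
end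
end

section
/- Assume (T1) α|μ| > |1−αδ|, (T2) μ² > 4(1−αδ), (T3) μ > 0. Define q̃(z) := (4z−(1−αδ))²/(4α²) and l̃(z) := μ²/4 − 4z. Then the discriminant α⁴ + α²μ²/4 − α²(1−αδ) is strictly positive, the numbers z^± := (1/2)[(1−αδ)/2 − α² ± √(α⁴ + α²μ²/4 − α²(1−αδ))] are real and distinct, they are exactly the two roots of the equation q̃(z) = l̃(z), and they satisfy z⁻ < 0 < z⁺ < z_P, where z_P := (1−αδ+αμ)/4. -/
open Complex Real Filter Set MeasureTheory ComplexConjugate Topology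

noncomputable section

/-- `q̃(z) = (4z−(1−αδ))²/(4α²)`. -/
def qtil (α δ : ℝ) (z : ℝ) : ℝ := (4*z - (1 - α*δ))^2/(4*α^2)

/-- The linear function `l̃(z) = μ²/4 − 4z` (untruncated). -/
def ltilLin (μ : ℝ) (z : ℝ) : ℝ := μ^2/4 - 4*z

/-- the roots `z^±` of `q̃ = l̃` are real, distinct, and satisfy
`z⁻ < 0 < z⁺ < z_P`. -/
theorem roots_q_eq_l (α δ μ : ℝ) (hα : 0 < α)
    (hT1 : α * |μ| > |1 - α*δ|) (hT2 : μ^2 > 4*(1 - α*δ)) (hT3 : 0 < μ) :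
    0 < discrm α δ μ ∧
    zminus α δ μ ≠ zplus α δ μ ∧
    (∀ z : ℝ, qtil α δ z = ltilLin μ z ↔ (z = zminus α δ μ ∨ z = zplus α δ μ)) ∧
    zminus α δ μ < 0 ∧ 0 < zplus α δ μ ∧ zplus α δ μ < zP α δ μ := by
  rw [abs_of_pos hT3] at hT1
  obtain ⟨h1, h2⟩ := abs_lt.mp hT1
  have hα2 : 0 < α^2 := by positivity
  have hαμ : 0 < α * μ := by positivity
  have hD : 0 < discrm α δ μ := by
    unfold discrm
    have : 0 < α^2 * (α^2 + (μ^2 - 4*(1 - α*δ))/4) := by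
      apply mul_pos hα2
      linarith
    linarith
  have hS : 0 < Real.sqrt (discrm α δ μ) := Real.sqrt_pos.mpr hD
  have hSS : Real.sqrt (discrm α δ μ) ^ 2 = α^4 + α^2*μ^2/4 - α^2*(1 - α*δ) :=
    Real.sq_sqrt hD.le
  unfold zminus zplus zP qtil ltilLin
  generalize Real.sqrt (discrm α δ μ) = S at hS hSS
  generalize 1 - α*δ = b at *
  have hprod : 0 < (α * μ - b) * (α * μ + b) := mul_pos (by linarith) (by linarith)
  have habs : |b/2 - α^2| < S := by
    apply abs_lt_of_sq_lt_sq _ hS.le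
    nlinarith
  obtain ⟨h3, h4⟩ := abs_lt.mp habs
  refine ⟨hD, by intro h; linarith, ?_, by linarith, by linarith, ?_⟩
  · intro z
    have key : (4*z - b)^2 - (μ^2/4 - 4*z) * (4*α^2)
        = 16 * ((z - (1/2)*(b/2 - α^2 - S)) * (z - (1/2)*(b/2 - α^2 + S))) := by
      linear_combination 4 * hSS
    rw [div_eq_iff (by positivity), ← sub_eq_zero, key, ← sub_eq_zero (b := (1/2)*(b/2 - α^2 - S)),
      ← sub_eq_zero (b := (1/2)*(b/2 - α^2 + S)), ← mul_eq_zero]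
    simp
  · have : S < α^2 + α*μ/2 := by
      apply lt_of_pow_lt_pow_left₀ 2 (by positivity)
      have : 0 < α^2 * (α * μ + b) := mul_pos hα2 (by linarith)
      nlinarith
    linarith
end
end

section
/- Assume (T1) α|μ| > |1−αδ|, (T2) μ² > 4(1−αδ), (T3) μ > 0. Define q̃(z) := (4z−(1−αδ))²/(4α²), c̃ := μ²/4, and l̃(z) := μ²/4 − 4z for z < μ²/16 with l̃(z) := 0 for z ≥ μ²/16. Then: (i) for z < z_L and for z > z_P, q̃(z) > max(l̃(z), c̃); (ii) for z_L < z < 0, l̃(z) > max(q̃(z), c̃); (iii) for 0 < z < z_P, c̃ > max(q̃(z), l̃(z)). -/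
open Complex Real Filter Set MeasureTheory ComplexConjugate Topology

noncomputable section

/-- The truncated linear function `l̃`. -/
def ltil (μ : ℝ) (z : ℝ) : ℝ := if z < μ^2/16 then μ^2/4 - 4*z else 0

/-- The constant `c̃ = μ²/4`. -/
def ctil (μ : ℝ) : ℝ := μ^2/4

/-- in the transsonic case the dominant exponent is `q̃` for `z < z_L` and
`z > z_P`, is `l̃` for `z_L < z < 0`, and is `c̃` for `0 < z < z_P`. -/
theorem dominant_exponent_configuration (α δ μ : ℝ) (hα : 0 < α)
    (hT1 : α * |μ| > |1 - α*δ|) (hT2 : μ^2 > 4*(1 - α*δ)) (hT3 : 0 < μ) :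
    (∀ z : ℝ, z < zminus α δ μ → qtil α δ z > max (ltil μ z) (ctil μ)) ∧
    (∀ z : ℝ, z > zP α δ μ → qtil α δ z > max (ltil μ z) (ctil μ)) ∧
    (∀ z : ℝ, zminus α δ μ < z → z < 0 → ltil μ z > max (qtil α δ z) (ctil μ)) ∧
    (∀ z : ℝ, 0 < z → z < zP α δ μ → ctil μ > max (qtil α δ z) (ltil μ z)) := by
  rw [abs_of_pos hT3] at hT1
  obtain ⟨hk1, hk2⟩ := abs_lt.mp hT1
  have hα2 : 0 < α^2 := by positivity
  have hD : 0 < discrm α δ μ := by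
    unfold discrm
    have h1 : 0 < α^2 * (μ^2 - 4*(1 - α*δ)) := mul_pos hα2 (by linarith)
    have h2 : 0 < α^4 := by positivity
    nlinarith
  have hs := Real.sq_sqrt hD.le
  have hs0 := Real.sqrt_pos.mpr hD
  have hle : zminus α δ μ < zplus α δ μ := by
    unfold zminus zplus; linarith
  have hf : ∀ z : ℝ, (4*z - (1 - α*δ))^2 - (μ^2/4 - 4*z) * (4*α^2)
      = 16 * ((z - zminus α δ μ) * (z - zplus α δ μ)) := by
    intro z
    unfold zminus zplus
    generalize Real.sqrt (discrm α δ μ) = r at hs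
    unfold discrm at hs
    linear_combination 4 * hs
  have h0 : (0 - zminus α δ μ) * (0 - zplus α δ μ) < 0 := by
    have := hf 0
    nlinarith
  have hm : zminus α δ μ < 0 := by
    by_contra h
    push Not at h
    nlinarith [mul_nonneg h (h.trans hle.le)]
  have hp : 0 < zplus α δ μ := by
    by_contra h
    push Not at h
    nlinarith [mul_nonneg (neg_nonneg.mpr hm.le) (neg_nonneg.mpr h)]
  have hl : ∀ z : ℝ, z < 0 → ltil μ z = μ^2/4 - 4*z := by
    intro z hz
    unfold ltil
    rw [if_pos]
    have : 0 < μ^2/16 := by positivity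
    linarith
  have hl2 : ∀ z : ℝ, 0 < z → ltil μ z < ctil μ := by
    intro z hz
    unfold ltil ctil
    split_ifs
    · linarith
    · positivity
  have h4 : 0 < 4*α^2 := by positivity
  refine ⟨?_, ?_, ?_, ?_⟩
  · intro z hz
    have hz0 : z < 0 := hz.trans hm
    have h1 : μ^2/4 - 4*z < qtil α δ z := by
      unfold qtil
      rw [lt_div_iff₀ h4]
      have := mul_pos_of_neg_of_neg (sub_neg.mpr hz) (sub_neg.mpr (hz.trans hle))
      linarith [hf z]
    refine max_lt ?_ ?_
    · rw [hl z hz0]; exact h1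
    · unfold ctil; linarith
  · intro z hz
    unfold zP at hz
    have h1 : ctil μ < qtil α δ z := by
      unfold qtil ctil
      rw [lt_div_iff₀ h4]
      have := mul_pos hα hT3
      nlinarith
    exact max_lt ((hl2 z (by linarith)).trans h1) h1
  · intro z hz hz0
    rw [hl z hz0]
    refine max_lt ?_ ?_
    · unfold qtil
      rw [div_lt_iff₀ h4]
      have := mul_neg_of_pos_of_neg (sub_pos.mpr hz) (sub_neg.mpr (hz0.trans hp))
      linarith [hf z]
    · unfold ctil; linarith
  · intro z hz0 hz
    unfold zP at hz
    refine max_lt ?_ (hl2 z hz0)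
    unfold qtil ctil
    rw [div_lt_iff₀ h4]
    have h1 : 0 < α*μ - (4*z - (1 - α*δ)) := by linarith
    have h2 : 0 < α*μ + (4*z - (1 - α*δ)) := by linarith
    nlinarith [mul_pos h1 h2]
end
end

section
/- Assume (T1) α|μ| > |1−αδ|, (T2) μ² > 4(1−αδ), (T3) μ > 0. For real x let Φ₊(x) := lim_{z→x, Im z>0} Φ(z). Then: Im Φ₊(x) = (iπ/2)(R(x) − 2Ω(x)) for x < z_L; Im Φ₊(x) = 0 for z_L < x < 0; Im Φ₊(x) = −(iπ/2)(R(x) − iμ) for 0 < x < z⁺; and Im Φ₊(x) = −(2π/α)|x − z_P| for x > z⁺. (In the first and third cases R(x) and Ω(x) are purely imaginary, so the stated right-hand sides are real.) -/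
open Complex Real Filter Set MeasureTheory ComplexConjugate Topology

noncomputable section

/-- The phase function `Φ(z)` obtained from Stirling asymptotics (principal branches). -/
def Phi (α δ μ : ℝ) (z : ℂ) : ℂ :=
  -(μ:ℂ) * Complex.log 2
  + (4/(α:ℂ)) * (z - (zP α δ μ : ℂ)) * Complex.log ((2/(α:ℂ)) * ((zP α δ μ : ℂ) - z))
  + (((μ:ℂ) - Complex.I * Rf μ z)/2) * Complex.log ((-Complex.I * (μ:ℂ) - Rf μ z)/2)
  + (((μ:ℂ) + Complex.I * Rf μ z)/2) * Complex.log ((-Complex.I * (μ:ℂ) + Rf μ z)/2)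
  - Complex.I * (Omg α δ z - Rf μ z / 2) * Complex.log (Omg α δ z - Rf μ z / 2)
  - Complex.I * (Omg α δ z + Rf μ z / 2) * Complex.log (Omg α δ z + Rf μ z / 2)


lemma aux_cs (t : ℝ) (ht : 0 ≤ t) (s : ℂ) (hs : s ≠ 0) :
    ((t : ℂ) * s) ^ ((1:ℂ)/2) = (Real.sqrt t : ℂ) * Complex.exp (Complex.log s / 2) := by
  rcases ht.eq_or_lt with h | h
  · subst h; simp
  · rw [Complex.cpow_def_of_ne_zero (mul_ne_zero (by exact_mod_cast h.ne') hs),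
      Complex.log_ofReal_mul h hs, add_mul, Complex.exp_add]
    congr 1
    · rw [Real.sqrt_eq_rpow, Real.rpow_def_of_pos h]; push_cast; rfl
    · congr 1; ring

lemma Rf_le (μ x : ℝ) (h : 16 * x ≤ μ^2) : Rf μ (x:ℂ) = Complex.I * (Real.sqrt (μ^2 - 16*x) : ℂ) := by
  have e : -Complex.I * (16 * (x:ℂ) - (μ:ℂ)^2) = ((μ^2 - 16*x : ℝ) : ℂ) * Complex.I := by
    push_cast; ring
  rw [Rf, e, aux_cs _ (by linarith) _ Complex.I_ne_zero, Complex.log_I, mul_left_comm, ← Complex.exp_add,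
    mul_comm Complex.I (Real.sqrt (μ^2 - 16*x) : ℂ)]
  congr 1
  refine Eq.trans ?_ Complex.exp_pi_div_two_mul_I
  congr 1; ring

lemma Rf_ge (μ x : ℝ) (h : μ^2 ≤ 16 * x) : Rf μ (x:ℂ) = (Real.sqrt (16*x - μ^2) : ℂ) := by
  have e : -Complex.I * (16 * (x:ℂ) - (μ:ℂ)^2) = ((16*x - μ^2 : ℝ) : ℂ) * (-Complex.I) := by
    push_cast; ring
  rw [Rf, e, aux_cs _ (by linarith) _ (neg_ne_zero.2 Complex.I_ne_zero), Complex.log_neg_I, mul_left_comm,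
    ← Complex.exp_add]
  convert mul_one _
  rw [← Complex.exp_zero]
  congr 1; ring

lemma Rf_cont (μ x : ℝ) : ContinuousAt (Rf μ) (x:ℂ) := by
  unfold Rf
  refine continuousAt_const.mul ?_
  set g : ℂ → ℂ := fun z => -Complex.I * (16 * z - (μ:ℂ)^2)
  have hg : ContinuousAt g (x:ℂ) := by fun_prop
  have h2 : ContinuousAt (fun w : ℂ => w ^ ((1:ℂ)/2)) (g x) := by
    by_cases h : 16 * x - μ^2 = 0
    · have : g x = 0 := by
        simp only [g]
        have : (16 * (x:ℂ) - (μ:ℂ)^2) = ((16 * x - μ^2 : ℝ):ℂ) := by push_cast; ring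
        rw [this, h]; simp
      rw [this]
      have := Complex.continuousAt_cpow_zero_of_re_pos (z := (1:ℂ)/2) (by norm_num)
      exact ContinuousAt.comp (f := fun w : ℂ => (w, (1:ℂ)/2)) this (by fun_prop)
    · apply continuousAt_id.cpow continuousAt_const
      rw [id, Complex.mem_slitPlane_iff]
      right
      simp [g, pow_two] 
      intro h'; apply h; nlinarith
  exact ContinuousAt.comp (f := g) h2 hg

def HH (w : ℂ) : ℝ := (w * Complex.log w).re

lemma HH_I (b : ℝ) : HH (Complex.I * b) = -(|b| * π / 2) := by
  rcases lt_trichotomy b 0 with h | h | h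
  · have : Complex.I * (b:ℂ) = ((-b : ℝ):ℂ) * (-Complex.I) := by push_cast; ring
    rw [HH, this, Complex.log_ofReal_mul (by linarith) (by simp), Complex.log_neg_I, abs_of_neg h]
    simp
    ring
  · simp [h, HH]
  · rw [HH, mul_comm Complex.I, Complex.log_ofReal_mul h (by simp), Complex.log_I, abs_of_pos h]
    simp
    ring

lemma HH_pair (s u : ℝ) (hu : 0 < u) :
    HH (-(Complex.I * u) - s) + HH (-(Complex.I * u) + s) = -(π * u) := by
  set w : ℂ := Complex.I * u + s with hw
  have him : w.im = u := by simp [hw]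
  have hre : w.re = s := by simp [hw]
  have e1 : -(Complex.I * u) - (s:ℂ) = -w := by rw [hw]; ring
  have e2 : -(Complex.I * u) + (s:ℂ) = conj w := by simp [hw]
  have ha : w.arg ≠ π := by
    intro h; rw [Complex.arg_eq_pi_iff] at h; linarith [h.2]
  rw [e1, e2, HH, HH]
  simp only [Complex.mul_re, Complex.log_re, Complex.log_im, norm_neg, Complex.arg_conj, ha,
    Complex.arg_neg_eq_arg_sub_pi_of_im_pos (him ▸ hu : 0 < w.im), Complex.norm_conj, Complex.neg_re, Complex.neg_im,
    Complex.conj_re, Complex.conj_im, him, hre, if_false]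
  ring

lemma T1_lim (w : ℂ → ℂ) (x : ℂ) (w0 : ℝ) (hw : ContinuousAt w x) (h0 : w x = w0)
    (hn : ∀ z : ℂ, 0 < z.im → (w z).im < 0) (hx : x.im = 0) :
    Tendsto (fun z => (w z * Complex.log (w z)).im) (𝓝[{z : ℂ | 0 < z.im}] x)
      (𝓝 (π * max (-w0) 0)) := by
  have hw' : Tendsto w (𝓝[{z : ℂ | 0 < z.im}] x) (𝓝 (w0:ℂ)) := h0 ▸ hw.mono_left nhdsWithin_le_nhds
  rcases lt_trichotomy w0 0 with h | h | h
  · have hc : ContinuousAt (fun v : ℂ => (v * (Complex.log (-v) - π * Complex.I)).im) (w0:ℂ) := by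
      have : ContinuousAt (fun v : ℂ => Complex.log (-v)) (w0:ℂ) := by
        apply ContinuousAt.clog (by fun_prop)
        rw [Complex.mem_slitPlane_iff]; left; simpa using h
      exact Complex.continuous_im.continuousAt.comp
        (continuousAt_id.mul (this.sub continuousAt_const))
    have h3 := hc.tendsto.comp hw'
    have e : (( (w0:ℂ) * (Complex.log (-(w0:ℂ)) - π * Complex.I)).im) = π * max (-w0) 0 := by
      rw [max_eq_left (by linarith), ← Complex.ofReal_neg, ← Complex.ofReal_log (by linarith)]
      simp; ring
    rw [← e]
    refine h3.congr' ?_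
    filter_upwards [self_mem_nhdsWithin] with z hz
    have := hn z hz
    have e2 : Complex.log (-w z) - π * Complex.I = Complex.log (w z) := by
      apply Complex.ext
      · simp [Complex.log_re]
      · simp [Complex.log_im, Complex.arg_neg_eq_arg_add_pi_of_im_neg this]
    simp only [Function.comp, e2]
  · subst h
    simp only [neg_zero, max_self, mul_zero]
    have hw0 : Tendsto w (𝓝[{z : ℂ | 0 < z.im}] x) (𝓝 0) := by simpa using hw'
    have h5 : Tendsto (fun v : ℂ => ‖v‖ * π + |‖v‖ * Real.log ‖v‖|) (𝓝 0) (𝓝 0) := by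
      have hc : Continuous (fun v : ℂ => ‖v‖ * π + |‖v‖ * Real.log ‖v‖|) :=
        (continuous_norm.mul continuous_const).add (Real.continuous_mul_log.comp continuous_norm).abs
      simpa using hc.tendsto 0
    refine squeeze_zero_norm ?_ (h5.comp hw0)
    intro z
    simp only [Function.comp, Complex.mul_im, Complex.log_im, Complex.log_re, Real.norm_eq_abs]
    refine (abs_add_le _ _).trans ?_
    rw [abs_mul, abs_mul, abs_mul, abs_norm]
    gcongr
    · exact Complex.abs_re_le_norm _
    · exact Complex.abs_arg_le_pi _
    · exact Complex.abs_im_le_norm _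
  · have hc : ContinuousAt (fun v : ℂ => (v * Complex.log v).im) (w0:ℂ) := by
      have : ContinuousAt (fun v : ℂ => Complex.log v) (w0:ℂ) := by
        apply continuousAt_clog
        rw [Complex.mem_slitPlane_iff]; left; simpa using h
      exact Complex.continuous_im.continuousAt.comp (continuousAt_id.mul this)
    have h3 := hc.tendsto.comp hw'
    have e : ((w0:ℂ) * Complex.log (w0:ℂ)).im = π * max (-w0) 0 := by
      rw [max_eq_right (by linarith), ← Complex.ofReal_log h.le]
      simp
    rw [← e]
    exact h3

lemma HH_tend (f : ℂ → ℂ) (x : ℂ) (hf : ContinuousAt f x) (h : f x ∈ Complex.slitPlane) :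
    Tendsto (fun z => HH (f z)) (𝓝[{z : ℂ | 0 < z.im}] x) (𝓝 (HH (f x))) := by
  have : ContinuousAt (fun z => HH (f z)) x :=
    Complex.continuous_re.continuousAt.comp (hf.mul (hf.clog h))
  exact this.tendsto.mono_left nhdsWithin_le_nhds

lemma Phi_im (α δ μ : ℝ) (z : ℂ) : (Phi α δ μ z).im =
    -2 * ((((2/(α:ℂ)) * ((zP α δ μ : ℂ) - z)) * Complex.log ((2/(α:ℂ)) * ((zP α δ μ : ℂ) - z))).im)
    + HH ((-Complex.I * (μ:ℂ) - Rf μ z)/2) + HH ((-Complex.I * (μ:ℂ) + Rf μ z)/2)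
    - HH (Omg α δ z - Rf μ z / 2) - HH (Omg α δ z + Rf μ z / 2) := by
  have hI : ∀ w : ℂ, HH w = (Complex.I * w * Complex.log w).im := by
    intro w; rw [mul_assoc, Complex.I_mul_im, HH]
  have h2 : (0:ℝ) = ((μ:ℂ) * Complex.log 2).im := by
    have : Complex.log 2 = ((Real.log 2 : ℝ) : ℂ) := by
      rw [Complex.ofReal_log (by norm_num)]; norm_num
    rw [this, ← Complex.ofReal_mul, Complex.ofReal_im]
  have h3 : ∀ w : ℂ, -2 * w.im = (-2 * w).im := by intro w; simp
  have key := congrArg Complex.im (show Phi α δ μ z = -((μ:ℂ) * Complex.log 2) +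
    -2 * (((2/(α:ℂ)) * ((zP α δ μ : ℂ) - z)) * Complex.log ((2/(α:ℂ)) * ((zP α δ μ : ℂ) - z)))
    + Complex.I * ((-Complex.I * (μ:ℂ) - Rf μ z)/2) * Complex.log ((-Complex.I * (μ:ℂ) - Rf μ z)/2)
    + Complex.I * ((-Complex.I * (μ:ℂ) + Rf μ z)/2) * Complex.log ((-Complex.I * (μ:ℂ) + Rf μ z)/2)
    - Complex.I * (Omg α δ z - Rf μ z / 2) * Complex.log (Omg α δ z - Rf μ z / 2)
    - Complex.I * (Omg α δ z + Rf μ z / 2) * Complex.log (Omg α δ z + Rf μ z / 2) from by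
      have i1 : Complex.I * ((-Complex.I * (μ:ℂ) - Rf μ z)/2) = ((μ:ℂ) - Complex.I * Rf μ z)/2 := by
        linear_combination (-(μ:ℂ)/2) * Complex.I_mul_I
      have i2 : Complex.I * ((-Complex.I * (μ:ℂ) + Rf μ z)/2) = ((μ:ℂ) + Complex.I * Rf μ z)/2 := by
        linear_combination (-(μ:ℂ)/2) * Complex.I_mul_I
      rw [i1, i2, Phi]
      ring)
  rw [key, hI, hI, hI, hI, h3]
  simp only [Complex.add_im, Complex.sub_im, Complex.neg_im, ← h2]
  ring

lemma Phi_lim (α δ μ x : ℝ) (hα : 0 < α)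
    (hA : (-Complex.I * (μ:ℂ) - Rf μ x)/2 ∈ Complex.slitPlane)
    (hB : (-Complex.I * (μ:ℂ) + Rf μ x)/2 ∈ Complex.slitPlane)
    (hC : Omg α δ x - Rf μ x / 2 ∈ Complex.slitPlane)
    (hD : Omg α δ x + Rf μ x / 2 ∈ Complex.slitPlane) :
    Tendsto (fun z => (Phi α δ μ z).im) (𝓝[{z : ℂ | 0 < z.im}] (x:ℂ))
      (𝓝 (-2 * (π * max (-(2/α*(zP α δ μ - x))) 0)
    + HH ((-Complex.I * (μ:ℂ) - Rf μ x)/2) + HH ((-Complex.I * (μ:ℂ) + Rf μ x)/2)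
    - HH (Omg α δ x - Rf μ x / 2) - HH (Omg α δ x + Rf μ x / 2))) := by
  have hR := Rf_cont μ x
  have hO : ContinuousAt (Omg α δ) (x:ℂ) := by unfold Omg; fun_prop
  simp only [Phi_im]
  have t1 := T1_lim (fun z => (2/(α:ℂ)) * ((zP α δ μ : ℂ) - z)) x (2/α*(zP α δ μ - x))
    (by fun_prop) (by push_cast; ring) (by
      intro z hz
      have : (2/(α:ℂ)) = ((2/α : ℝ):ℂ) := by push_cast; ring
      simp only [this, Complex.re_ofReal_mul, Complex.im_ofReal_mul, Complex.sub_im, Complex.ofReal_im]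
      have : 0 < 2/α := by positivity
      nlinarith) (by simp)
  have a := HH_tend (fun z => (-Complex.I * (μ:ℂ) - Rf μ z)/2) x (by fun_prop) hA
  have b := HH_tend (fun z => (-Complex.I * (μ:ℂ) + Rf μ z)/2) x (by fun_prop) hB
  have c := HH_tend (fun z => Omg α δ z - Rf μ z / 2) x (by fun_prop) hC
  have d := HH_tend (fun z => Omg α δ z + Rf μ z / 2) x (by fun_prop) hD
  exact ((((t1.const_mul (-2)).add a).add b).sub c).sub d

lemma Omg_real (α δ x : ℝ) (hα : 0 < α) :
    Omg α δ x = -(Complex.I * ((2/α*(x - (1-α*δ)/4) : ℝ) : ℂ)) := by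
  have h : (α:ℂ) ≠ 0 := by exact_mod_cast hα.ne'
  have hI := Complex.I_ne_zero
  unfold Omg; push_cast; field_simp; 
  linear_combination (4*(x:ℂ)-(1-α*δ)) * Complex.I_mul_I

lemma slit_I (b : ℝ) (hb : b ≠ 0) : Complex.I * (b:ℂ) ∈ Complex.slitPlane := by
  rw [Complex.mem_slitPlane_iff]; right; simpa using hb

lemma max_id (a b : ℝ) : |a + b| + |a - b| = 2 * max |a| |b| := by
  rcases le_total a 0 with h1 | h1 <;> rcases le_total b 0 with h2 | h2 <;>
  rcases le_total |a| |b| with h3 | h3 <;> (first | rw [max_eq_right h3] | rw [max_eq_left h3]) <;>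
  simp only [abs_of_nonneg, abs_of_nonpos, h1, h2] at h3 ⊢ <;>
  rcases abs_cases (a+b) with h4 | h4 <;> rcases abs_cases (a-b) with h5 | h5 <;> linarith

/-- Limit for `16 x ≤ μ²`. -/
lemma Phi_lim_low (α δ μ x r u : ℝ) (hα : 0 < α) (hμ : 0 < μ) (h : 16 * x ≤ μ^2)
    (hr : r = Real.sqrt (μ^2 - 16*x)) (hu : u = 2/α*(x - (1-α*δ)/4))
    (h0 : r ≠ μ) (h1 : r ≠ 2*|u|) :
    Tendsto (fun z => (Phi α δ μ z).im) (𝓝[{z : ℂ | 0 < z.im}] (x:ℂ))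
      (𝓝 (-π * max (2*u-μ) 0 - π/2 * max μ r + π/2 * max (2*|u|) r)) := by
  have hr0 : 0 ≤ r := hr ▸ Real.sqrt_nonneg _
  have hR : Rf μ (x:ℂ) = Complex.I * (r:ℂ) := by rw [hr]; exact Rf_le μ x h
  have hO : Omg α δ x = -(Complex.I * (u:ℂ)) := by rw [hu]; exact Omg_real α δ x hα
  have eA : (-Complex.I * (μ:ℂ) - Rf μ x)/2 = Complex.I * ((-(μ + r)/2 : ℝ):ℂ) := by
    rw [hR]; push_cast; ring
  have eB : (-Complex.I * (μ:ℂ) + Rf μ x)/2 = Complex.I * ((-(μ - r)/2 : ℝ):ℂ) := by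
    rw [hR]; push_cast; ring
  have eC : Omg α δ x - Rf μ x / 2 = Complex.I * ((-(2*u + r)/2 : ℝ):ℂ) := by
    rw [hR, hO]; push_cast; ring
  have eD : Omg α δ x + Rf μ x / 2 = Complex.I * ((-(2*u - r)/2 : ℝ):ℂ) := by
    rw [hR, hO]; push_cast; ring
  have n1 : 2*u + r ≠ 0 := by
    intro hh; apply h1; rw [abs_of_nonpos (by linarith)]; linarith
  have n2 : 2*u - r ≠ 0 := by
    intro hh; apply h1; rw [abs_of_nonneg (by linarith)]; linarith
  have L := Phi_lim α δ μ x hα (eA ▸ slit_I _ (by intro hh; linarith))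
    (eB ▸ slit_I _ (by intro hh; apply h0; linarith))
    (eC ▸ slit_I _ (by intro hh; apply n1; linarith))
    (eD ▸ slit_I _ (by intro hh; apply n2; linarith))
  rw [eA, eB, eC, eD, HH_I, HH_I, HH_I, HH_I] at L
  convert L using 2
  have m1 := max_id μ r
  have m2 := max_id (2*u) r
  rw [abs_mul, abs_of_pos (by norm_num : (0:ℝ) < 2)] at m2
  rw [abs_of_nonneg hr0] at m1 m2
  rw [abs_of_pos hμ] at m1
  have q : ∀ y : ℝ, |(-y)/2| = |y|/2 := by
    intro y; rw [abs_div, abs_neg]; norm_num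
  rw [q, q, q, q]
  have e : -(2/α*(zP α δ μ - x)) = (2*u-μ)/2 := by
    rw [hu, zP]; field_simp; ring
  rw [e]
  have e3 : max ((2*u-μ)/2) 0 = max (2*u-μ) 0 / 2 := by
    rw [max_div_div_right (by norm_num : (0:ℝ) ≤ 2) (2*u-μ) 0 |>.symm]; simp
  rw [e3]
  linear_combination (-π/4) * (-m1) + (-π/4) * m2

lemma Phi_lim_high (α δ μ x u : ℝ) (hα : 0 < α) (hμ : 0 < μ) (h : μ^2 ≤ 16 * x)
    (hu : u = 2/α*(x - (1-α*δ)/4)) (hu0 : 0 < u) :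
    Tendsto (fun z => (Phi α δ μ z).im) (𝓝[{z : ℂ | 0 < z.im}] (x:ℂ))
      (𝓝 (-π * max (2*u-μ) 0 - π/2 * μ + π * u)) := by
  have hR : Rf μ (x:ℂ) = (Real.sqrt (16*x-μ^2):ℂ) := Rf_ge μ x h
  set s := Real.sqrt (16*x-μ^2)
  have hO : Omg α δ x = -(Complex.I * (u:ℂ)) := by rw [hu]; exact Omg_real α δ x hα
  have sl : ∀ a b : ℝ, 0 < a → -(Complex.I * (a:ℂ)) + (b:ℂ) ∈ Complex.slitPlane := by
    intro a b ha; rw [Complex.mem_slitPlane_iff]; right; simpa using ha.ne'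
  have sl' : ∀ a b : ℝ, 0 < a → -(Complex.I * (a:ℂ)) - (b:ℂ) ∈ Complex.slitPlane := by
    intro a b ha; rw [Complex.mem_slitPlane_iff]; right; simpa using ha.ne'
  have eA : (-Complex.I * (μ:ℂ) - Rf μ x)/2 = -(Complex.I * ((μ/2:ℝ):ℂ)) - ((s/2:ℝ):ℂ) := by
    rw [hR]; push_cast; ring
  have eB : (-Complex.I * (μ:ℂ) + Rf μ x)/2 = -(Complex.I * ((μ/2:ℝ):ℂ)) + ((s/2:ℝ):ℂ) := by
    rw [hR]; push_cast; ring
  have eC : Omg α δ x - Rf μ x / 2 = -(Complex.I * (u:ℂ)) - ((s/2:ℝ):ℂ) := by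
    rw [hR, hO]; push_cast; ring
  have eD : Omg α δ x + Rf μ x / 2 = -(Complex.I * (u:ℂ)) + ((s/2:ℝ):ℂ) := by
    rw [hR, hO]; push_cast; ring
  have L := Phi_lim α δ μ x hα (eA ▸ sl' _ _ (by linarith)) (eB ▸ sl _ _ (by linarith))
    (eC ▸ sl' _ _ hu0) (eD ▸ sl _ _ hu0)
  rw [eA, eB, eC, eD] at L
  have p1 := HH_pair (s/2) (μ/2) (by linarith)
  have p2 := HH_pair (s/2) u hu0
  convert L using 2
  have e : -(2/α*(zP α δ μ - x)) = (2*u-μ)/2 := by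
    rw [hu, zP]; field_simp; ring
  rw [e]
  have e3 : max ((2*u-μ)/2) 0 = max (2*u-μ) 0 / 2 := by
    rw [max_div_div_right (by norm_num : (0:ℝ) ≤ 2) (2*u-μ) 0 |>.symm]; simp
  rw [e3]
  linear_combination -p1 + p2

set_option maxHeartbeats 1600000 in
/-- the boundary values of `Im Φ` on the real axis. -/
theorem ImPhi_boundary_values (α δ μ : ℝ) (hα : 0 < α)
    (hT1 : α * |μ| > |1 - α*δ|) (hT2 : μ^2 > 4*(1 - α*δ)) (hT3 : 0 < μ) :
    (∀ x : ℝ, x < zminus α δ μ →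
      (Complex.I * (π:ℂ)/2 * (Rf μ (x:ℂ) - 2 * Omg α δ (x:ℂ))).im = 0 ∧
      Filter.Tendsto (fun z => (Phi α δ μ z).im) (𝓝[{z : ℂ | 0 < z.im}] (x:ℂ))
        (𝓝 ((Complex.I * (π:ℂ)/2 * (Rf μ (x:ℂ) - 2 * Omg α δ (x:ℂ))).re))) ∧
    (∀ x : ℝ, zminus α δ μ < x → x < 0 →
      Filter.Tendsto (fun z => (Phi α δ μ z).im) (𝓝[{z : ℂ | 0 < z.im}] (x:ℂ)) (𝓝 0)) ∧
    (∀ x : ℝ, 0 < x → x < zplus α δ μ →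
      (-(Complex.I * (π:ℂ)/2) * (Rf μ (x:ℂ) - Complex.I * (μ:ℂ))).im = 0 ∧
      Filter.Tendsto (fun z => (Phi α δ μ z).im) (𝓝[{z : ℂ | 0 < z.im}] (x:ℂ))
        (𝓝 ((-(Complex.I * (π:ℂ)/2) * (Rf μ (x:ℂ) - Complex.I * (μ:ℂ))).re))) ∧
    (∀ x : ℝ, zplus α δ μ < x →
      Filter.Tendsto (fun z => (Phi α δ μ z).im) (𝓝[{z : ℂ | 0 < z.im}] (x:ℂ))
        (𝓝 (-(2*π/α) * |x - zP α δ μ|))) := by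
  have hd : 0 ≤ discrm α δ μ := by unfold discrm; nlinarith [sq_nonneg α, sq_nonneg (α^2)]
  have hsq := Real.sq_sqrt hd
  have hs0 := Real.sqrt_nonneg (discrm α δ μ)
  have fac : ∀ x : ℝ, (x - zminus α δ μ) * (x - zplus α δ μ) =
      (x - (1-α*δ)/4)^2 + α^2 * x - α^2*μ^2/16 := by
    intro x; unfold zminus zplus; unfold discrm at *; linear_combination (-1/4) * hsq
  have hle : zminus α δ μ ≤ zplus α δ μ := by unfold zminus zplus; linarith
  have hα2 : 0 < α^2 := by positivity
  have hT1' : |1 - α*δ| < α * μ := by rwa [abs_of_pos hT3] at hT1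
  have hab := abs_lt.1 hT1'
  -- interlacing
  have btw : ∀ y : ℝ, (y - (1-α*δ)/4)^2 + α^2 * y - α^2*μ^2/16 < 0 →
      zminus α δ μ < y ∧ y < zplus α δ μ := by
    intro y hy; rw [← fac] at hy
    rcases mul_neg_iff.1 hy with h | h
    · constructor <;> linarith [h.1, h.2]
    · exfalso; linarith [h.1, h.2]
  have b0 := btw 0 (by nlinarith)
  have bc := btw ((1-α*δ)/4) (by nlinarith)
  have hp : zplus α δ μ ≤ μ^2/16 := by
    by_contra hh
    push Not at hh
    have := fac (μ^2/16)
    have h1 : 0 < μ^2/16 - zminus α δ μ := by nlinarith [sq_nonneg μ]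
    nlinarith [sq_nonneg (μ^2/16 - (1-α*δ)/4), mul_pos h1 (sub_pos.2 hh)]
  have hu : ∀ x : ℝ, x - (1-α*δ)/4 = α/2 * (2/α*(x - (1-α*δ)/4)) := by
    intro x; field_simp
  have hrsq : ∀ x : ℝ, 16*x ≤ μ^2 → Real.sqrt (μ^2-16*x)^2 = μ^2 - 16*x := fun x h =>
    Real.sq_sqrt (by linarith)
  -- comparison of r and 2|u|
  have cmp : ∀ x : ℝ, 16*x ≤ μ^2 → (x - zminus α δ μ) * (x - zplus α δ μ) =
      α^2/16 * ((2*|2/α*(x - (1-α*δ)/4)|)^2 - Real.sqrt (μ^2-16*x)^2) := by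
    intro x h
    rw [fac, hrsq x h, mul_pow, sq_abs, hu x]
    field_simp
    ring
  refine ⟨?_, ?_, ?_, ?_⟩
  · intro x hx
    have h16 : 16*x ≤ μ^2 := by nlinarith
    have c := cmp x h16
    have hs := hrsq x h16
    have hux := hu x
    have hL := Phi_lim_low α δ μ x _ _ hα hT3 h16 rfl rfl
    have eR := Rf_le μ x h16
    have eO := Omg_real α δ x hα
    have r0 := Real.sqrt_nonneg (μ^2 - 16*x)
    set r := Real.sqrt (μ^2-16*x)
    set u := 2/α*(x - (1-α*δ)/4)
    have hun : u < 0 := by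
      by_contra hh; push Not at hh
      have : 0 ≤ α/2 * u := by positivity
      linarith [bc.1]
    have hrm : μ < r := by apply lt_of_pow_lt_pow_left₀ 2 r0; nlinarith [b0.1]
    have hru : r < 2*|u| := by
      apply lt_of_pow_lt_pow_left₀ 2 (by positivity)
      have : 0 < (x - zminus α δ μ) * (x - zplus α δ μ) :=
        mul_pos_of_neg_of_neg (by linarith) (by linarith)
      rw [c] at this
      linarith [(mul_pos_iff_of_pos_left (by positivity : 0 < α^2/16)).1 this]
    have hL := hL hrm.ne' hru.ne
    have e : Complex.I * (π:ℂ)/2 * (Rf μ (x:ℂ) - 2 * Omg α δ (x:ℂ)) = ((π/2 * (-r - 2*u) : ℝ):ℂ) := by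
      rw [eR, eO]; push_cast
      linear_combination ((π:ℂ)/2 * (r + 2*u)) * Complex.I_mul_I
    rw [e]
    refine ⟨Complex.ofReal_im _, ?_⟩
    rw [Complex.ofReal_re]
    convert hL using 2
    rw [max_eq_right (by linarith), max_eq_right hrm.le, max_eq_left hru.le, abs_of_neg hun]
    ring
  · intro x hx hx0
    have h16 : 16*x ≤ μ^2 := by nlinarith
    have c := cmp x h16
    have hs := hrsq x h16
    have hux := hu x
    have hL := Phi_lim_low α δ μ x _ _ hα hT3 h16 rfl rfl
    have r0 := Real.sqrt_nonneg (μ^2 - 16*x)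
    set r := Real.sqrt (μ^2-16*x)
    set u := 2/α*(x - (1-α*δ)/4)
    have hrm : μ < r := by apply lt_of_pow_lt_pow_left₀ 2 r0; nlinarith
    have hru : 2*|u| < r := by
      apply lt_of_pow_lt_pow_left₀ 2 r0
      have : (x - zminus α δ μ) * (x - zplus α δ μ) < 0 :=
        mul_neg_of_pos_of_neg (by linarith) (by linarith)
      rw [c] at this
      by_contra hh
      have h9 := mul_nonneg (by positivity : 0 ≤ α^2/16) (sub_nonneg.2 (not_lt.1 hh))
      linarith
    have hL := hL hrm.ne' hru.ne'
    convert hL using 2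
    have : 2*u - μ ≤ 0 := by
      by_contra hh; push Not at hh
      have := mul_pos hα hh
      nlinarith
    rw [max_eq_right this, max_eq_right hrm.le, max_eq_right hru.le]
    ring
  · intro x hx0 hx
    have h16 : 16*x ≤ μ^2 := by linarith
    have c := cmp x h16
    have hs := hrsq x h16
    have hux := hu x
    have hL := Phi_lim_low α δ μ x _ _ hα hT3 h16 rfl rfl
    have eR := Rf_le μ x h16
    have r0 := Real.sqrt_nonneg (μ^2 - 16*x)
    set r := Real.sqrt (μ^2-16*x)
    set u := 2/α*(x - (1-α*δ)/4)
    have hrm : r < μ := by apply lt_of_pow_lt_pow_left₀ 2 hT3.le; nlinarith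
    have hru : 2*|u| < r := by
      apply lt_of_pow_lt_pow_left₀ 2 r0
      have : (x - zminus α δ μ) * (x - zplus α δ μ) < 0 :=
        mul_neg_of_pos_of_neg (by linarith) (by linarith)
      rw [c] at this
      by_contra hh
      have h9 := mul_nonneg (by positivity : 0 ≤ α^2/16) (sub_nonneg.2 (not_lt.1 hh))
      linarith
    have hL := hL hrm.ne hru.ne'
    have e : -(Complex.I * (π:ℂ)/2) * (Rf μ (x:ℂ) - Complex.I * (μ:ℂ)) = ((π/2 * (r - μ) : ℝ):ℂ) := by
      rw [eR]; push_cast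
      linear_combination (-(π:ℂ)/2 * (r - μ)) * Complex.I_mul_I
    rw [e]
    refine ⟨Complex.ofReal_im _, ?_⟩
    rw [Complex.ofReal_re]
    convert hL using 2
    rw [max_eq_right (by linarith [le_abs_self u]), max_eq_left hrm.le, max_eq_right hru.le]
    ring
  · intro x hx
    have hux := hu x
    have hup : 0 < 2/α*(x - (1-α*δ)/4) := mul_pos (by positivity) (by linarith)
    have e : -(2*π/α) * |x - zP α δ μ| = -π * max (2*(2/α*(x - (1-α*δ)/4))-μ) 0 - π/2 * μ
        + π * (2/α*(x - (1-α*δ)/4)) := by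
      have e1 : x - zP α δ μ = α/4 * (2*(2/α*(x - (1-α*δ)/4))-μ) := by
        unfold zP; field_simp; ring
      rw [e1, abs_mul, abs_of_pos (by positivity : 0 < α/4)]
      set u := 2/α*(x - (1-α*δ)/4)
      have e2 : -(2*π/α) * (α/4 * |2*u-μ|) = -(π/2) * |2*u-μ| := by field_simp; norm_num
      rw [e2]
      rcases le_total (2*u-μ) 0 with h | h
      · rw [max_eq_right h, abs_of_nonpos h]; ring
      · rw [max_eq_left h, abs_of_nonneg h]; ring
    rw [e]
    rcases le_total (16*x) (μ^2) with h16 | h16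
    · have c := cmp x h16
      have hs := hrsq x h16
      have hL := Phi_lim_low α δ μ x _ _ hα hT3 h16 rfl rfl
      have r0 := Real.sqrt_nonneg (μ^2 - 16*x)
      set r := Real.sqrt (μ^2-16*x)
      set u := 2/α*(x - (1-α*δ)/4)
      have hrm : r < μ := by apply lt_of_pow_lt_pow_left₀ 2 hT3.le; nlinarith
      have hru : r < 2*|u| := by
        apply lt_of_pow_lt_pow_left₀ 2 (by positivity)
        have : 0 < (x - zminus α δ μ) * (x - zplus α δ μ) :=
          mul_pos (by linarith) (by linarith)
        rw [c] at this
        linarith [(mul_pos_iff_of_pos_left (by positivity : 0 < α^2/16)).1 this]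
      have hL := hL hrm.ne hru.ne
      convert hL using 2
      rw [max_eq_left hrm.le, max_eq_left hru.le, abs_of_pos hup]
      ring
    · exact Phi_lim_high α δ μ x _ hα hT3 h16 rfl hup
end
end
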